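/- arXiv:2602.15977 — 2 statements merged into one kernel-verified Lean document; each statement's English description precedes it below -/
import Mathlib

section
/- Let T be a rooted tree and S ⊆ V(T). Then the number of orderings of S consistent with the tree order satisfies |LE_S(T)| = |S|! · ∏_{u ∈ S} 1/|V(T_u) ∩ S|; equivalently, |LE_S(T)| · ∏_{u ∈ S} |V(T_u) ∩ S| = |S|!. -/
/-- A rooted tree on a node set `α`, given by its root and parent function
(the root is its own parent, and every node reaches the root by iterating `parent`). -/
structure RTree (α : Type*) where
  root : α
  parent : α → α
  parent_root : parent root = root
  reaches_root : ∀ v, ∃ k, parent^[k] v = root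

namespace RTree

variable {α : Type*}

/-- `u` is a (weak) ancestor of `v` in `T`. -/
def ancestor (T : RTree α) (u v : α) : Prop := ∃ k, T.parent^[k] v = u

/-- `u` is a proper ancestor of `v` in `T`. -/
def properAncestor (T : RTree α) (u v : α) : Prop := T.ancestor u v ∧ u ≠ v

/-- The node set of the subtree `T_v` of `T` rooted at `v`,
i.e. `v` together with all of its descendants. -/
def subtree (T : RTree α) (v : α) : Set α := {u | T.ancestor v u}

/-- A leaf of `T` is a node with no children. -/
def IsLeaf (T : RTree α) (v : α) : Prop := ∀ u, T.parent u = v → u = v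

end RTree

/-- The set `LE_S(T)` of orderings of `S` consistent with the tree order of `T`, i.e.
linear extensions of the restriction of the tree order to `S`. -/
def linExtsOn {α : Type*} (T : RTree α) (S : Finset α) : Set ({x // x ∈ S} ≃ Fin S.card) :=
  {f | ∀ u v : {x // x ∈ S}, T.properAncestor u.1 v.1 → f v < f u}

section ForestOrder

open scoped Classical

variable {α : Type*} [PartialOrder α]

/-- The linear extensions of the restriction of the order to `S`, encoded as rank functions
which vanish outside `S`. -/
def rankFunctions (S : Finset α) : Set (α → ℕ) :=
  {f | (∀ a ∈ S, f a < S.card) ∧ Set.InjOn f S ∧ (∀ a ∉ S, f a = 0) ∧ StrictMonoOn f S}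

theorem rankFunctions_empty : rankFunctions (∅ : Finset α) = {fun _ => 0} := by
  ext f
  simp [rankFunctions, StrictMonoOn, funext_iff]

theorem update_mem_rankFunctions {S : Finset α} {r : α} (hr : Maximal (· ∈ S) r) {f : α → ℕ}
    (hf : f ∈ rankFunctions (S.erase r)) :
    Function.update f r (S.card - 1) ∈ rankFunctions S := by
  obtain ⟨hlt, hinj, hzero, hmono⟩ := hf
  have hcard := Finset.card_erase_of_mem hr.prop
  have hpos : 0 < S.card := Finset.card_pos.2 ⟨r, hr.prop⟩
  rw [hcard] at hlt
  refine ⟨fun a ha => ?_, fun a ha b hb hab => ?_, fun a ha => ?_, fun a ha b hb hab => ?_⟩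
  · by_cases h : a = r
    · subst h; simp [hpos]
    · have := hlt a (Finset.mem_erase.2 ⟨h, ha⟩)
      simp only [Function.update_of_ne h]; omega
  · by_cases h : a = r <;> by_cases h' : b = r
    · rw [h, h']
    · subst h
      have := hlt b (Finset.mem_erase.2 ⟨h', hb⟩)
      simp only [Function.update_self, Function.update_of_ne h'] at hab; omega
    · subst h'
      have := hlt a (Finset.mem_erase.2 ⟨h, ha⟩)
      simp only [Function.update_self, Function.update_of_ne h] at hab; omega
    · simp only [Function.update_of_ne h, Function.update_of_ne h'] at hab
      exact hinj (by simpa [h] using ha) (by simpa [h'] using hb) hab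
  · have h : a ≠ r := fun h => ha (h ▸ hr.prop)
    rw [Function.update_of_ne h]
    exact hzero a fun h => ha (Finset.mem_of_mem_erase h)
  · have h : a ≠ r := by
      rintro rfl
      exact hab.not_ge (hr.le_of_ge hb hab.le)
    rw [Function.update_of_ne h]
    by_cases h' : b = r
    · subst h'
      simpa using hlt a (Finset.mem_erase.2 ⟨h, ha⟩)
    · rw [Function.update_of_ne h']
      exact hmono (by simpa [h] using ha) (by simpa [h'] using hb) hab

theorem exists_update_of_mem_rankFunctions {S : Finset α} (hS : S.Nonempty) {f : α → ℕ}
    (hf : f ∈ rankFunctions S) :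
    ∃ r, Maximal (· ∈ S) r ∧ ∃ g ∈ rankFunctions (S.erase r),
      Function.update g r (S.card - 1) = f := by
  obtain ⟨hlt, hinj, hzero, hmono⟩ := hf
  have hpos : 0 < S.card := hS.card_pos
  have himage : S.image f = Finset.range S.card := by
    refine Finset.eq_of_subset_of_card_le (fun x hx => ?_) ?_
    · obtain ⟨a, ha, rfl⟩ := Finset.mem_image.1 hx
      exact Finset.mem_range.2 (hlt a ha)
    · rw [Finset.card_image_of_injOn hinj, Finset.card_range]
  obtain ⟨r, hr, hfr⟩ : ∃ r ∈ S, f r = S.card - 1 := by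
    rw [← Finset.mem_image, himage, Finset.mem_range]; omega
  refine ⟨r, ⟨hr, fun b hb hrb => ?_⟩, Function.update f r 0,
    ⟨fun a ha => ?_, fun a ha b hb hab => ?_, fun a ha => ?_, fun a ha b hb hab => ?_⟩, ?_⟩
  · by_contra h
    have := hmono hr hb (lt_of_le_not_ge hrb h)
    have := hlt b hb
    omega
  · obtain ⟨h, ha⟩ := Finset.mem_erase.1 ha
    have h1 := hlt a ha
    have h2 : f a ≠ f r := fun h' => h (hinj ha hr h')
    rw [Function.update_of_ne h, Finset.card_erase_of_mem hr]
    omega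
  · obtain ⟨h, ha⟩ := Finset.mem_erase.1 ha
    obtain ⟨h', hb⟩ := Finset.mem_erase.1 hb
    rw [Function.update_of_ne h, Function.update_of_ne h'] at hab
    exact hinj ha hb hab
  · by_cases h : a = r
    · subst h; simp
    · rw [Function.update_of_ne h]
      exact hzero a fun h' => ha (Finset.mem_erase.2 ⟨h, h'⟩)
  · obtain ⟨h, ha⟩ := Finset.mem_erase.1 ha
    obtain ⟨h', hb⟩ := Finset.mem_erase.1 hb
    rw [Function.update_of_ne h, Function.update_of_ne h']
    exact hmono ha hb hab
  · rw [Function.update_idem, ← hfr, Function.update_eq_self]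

theorem rankFunctions_eq_biUnion {S : Finset α} (hS : S.Nonempty) :
    rankFunctions S = ⋃ r ∈ S.filter (Maximal (· ∈ S)),
      (fun f => Function.update f r (S.card - 1)) '' rankFunctions (S.erase r) := by
  ext f
  simp only [Set.mem_iUnion, Finset.mem_filter, Set.mem_image, exists_prop]
  constructor
  · intro hf
    obtain ⟨r, hr, hg⟩ := exists_update_of_mem_rankFunctions hS hf
    exact ⟨r, ⟨hr.prop, hr⟩, hg⟩
  · rintro ⟨r, ⟨-, hr⟩, g, hg, rfl⟩
    exact update_mem_rankFunctions hr hg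

theorem injOn_update_rankFunctions (S : Finset α) (r : α) (n : ℕ) :
    Set.InjOn (fun f => Function.update f r n) (rankFunctions (S.erase r)) := by
  intro f hf g hg hfg
  ext a
  by_cases h : a = r
  · subst h
    rw [hf.2.2.1 a (by simp), hg.2.2.1 a (by simp)]
  · simpa [h] using congrFun hfg a

theorem finite_rankFunctions (S : Finset α) : (rankFunctions S).Finite := by
  induction S using Finset.strongInduction with
  | H S ih =>
    rcases S.eq_empty_or_nonempty with rfl | hS
    · rw [rankFunctions_empty]; exact Set.finite_singleton _
    · rw [rankFunctions_eq_biUnion hS]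
      refine Set.Finite.biUnion (Finset.finite_toSet _) fun r hr => (ih _ ?_).image _
      exact Finset.erase_ssubset (Finset.mem_filter.1 hr).1

theorem ncard_rankFunctions {S : Finset α} (hS : S.Nonempty) :
    (rankFunctions S).ncard =
      ∑ r ∈ S.filter (Maximal (· ∈ S)), (rankFunctions (S.erase r)).ncard := by
  have hU : rankFunctions S = ↑((S.filter (Maximal (· ∈ S))).biUnion fun r =>
      (finite_rankFunctions (S.erase r)).toFinset.image
        fun f => Function.update f r (S.card - 1)) := by
    rw [rankFunctions_eq_biUnion hS]
    simp
  rw [hU, Set.ncard_coe_finset, Finset.card_biUnion]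
  · refine Finset.sum_congr rfl fun r _ => ?_
    rw [Finset.card_image_of_injOn (by simpa using injOn_update_rankFunctions S r _),
      Set.ncard_eq_toFinset_card _ (finite_rankFunctions _)]
  · intro r hr s hs hrs
    refine Finset.disjoint_left.2 ?_
    simp only [Finset.mem_image, Set.Finite.mem_toFinset]
    rintro _ ⟨f, hf, rfl⟩ ⟨g, hg, hfg⟩
    have hfs := (update_mem_rankFunctions (Finset.mem_filter.1 hr).2 hf).2.1
    refine hrs (hfs (Finset.mem_filter.1 hr).1 (Finset.mem_filter.1 hs).1 ?_)
    have := congrFun hfg s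
    simp only [Function.update_self] at this ⊢
    exact this

theorem sum_card_filter_le_maximal
    (hα : ∀ a b c : α, a ≤ b → a ≤ c → b ≤ c ∨ c ≤ b) (S : Finset α) :
    ∑ r ∈ S.filter (Maximal (· ∈ S)), (S.filter (· ≤ r)).card = S.card := by
  rw [← Finset.card_biUnion]
  · congr 1
    ext a
    simp only [Finset.mem_biUnion, Finset.mem_filter]
    constructor
    · rintro ⟨_, _, ha, _⟩
      exact ha
    · intro ha
      obtain ⟨r, har, hr⟩ := S.exists_le_maximal ha
      exact ⟨r, ⟨hr.prop, hr⟩, ha, har⟩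
  · intro r hr s hs hrs
    refine Finset.disjoint_left.2 fun a har has => ?_
    have hr := (Finset.mem_filter.1 hr).2
    have hs := (Finset.mem_filter.1 hs).2
    rcases hα a r s (Finset.mem_filter.1 har).2 (Finset.mem_filter.1 has).2 with h | h
    · exact hrs (hr.eq_of_le hs.prop h)
    · exact hrs (hs.eq_of_le hr.prop h).symm

/-- The hook-length formula for a partial order whose principal up-sets are chains. -/
theorem ncard_rankFunctions_mul_prod
    (hα : ∀ a b c : α, a ≤ b → a ≤ c → b ≤ c ∨ c ≤ b) (S : Finset α) :
    (rankFunctions S).ncard * ∏ u ∈ S, (S.filter (· ≤ u)).card = S.card.factorial := by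
  induction S using Finset.strongInduction with
  | H S ih =>
    rcases S.eq_empty_or_nonempty with rfl | hS
    · simp [rankFunctions_empty]
    rw [ncard_rankFunctions hS, Finset.sum_mul]
    have key : ∀ r ∈ S.filter (Maximal (· ∈ S)),
        (rankFunctions (S.erase r)).ncard * ∏ u ∈ S, (S.filter (· ≤ u)).card =
          (S.filter (· ≤ r)).card * (S.card - 1).factorial := by
      intro r hr
      obtain ⟨hrS, hr⟩ := Finset.mem_filter.1 hr
      rw [← Finset.card_erase_of_mem hrS, ← ih _ (Finset.erase_ssubset hrS),
        ← Finset.mul_prod_erase S _ hrS, mul_left_comm]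
      congr 2
      refine Finset.prod_congr rfl fun u hu => congrArg Finset.card ?_
      obtain ⟨hur, huS⟩ := Finset.mem_erase.1 hu
      ext a
      simp only [Finset.mem_filter, Finset.mem_erase]
      refine ⟨fun ⟨ha, hau⟩ => ⟨⟨?_, ha⟩, hau⟩, fun ⟨⟨_, ha⟩, hau⟩ => ⟨ha, hau⟩⟩
      rintro rfl
      exact hur (hr.eq_of_le huS hau).symm
    rw [Finset.sum_congr rfl key, ← Finset.sum_mul, sum_card_filter_le_maximal hα,
      Nat.mul_factorial_pred hS.card_pos.ne']

/-- Rank functions on `S` correspond to order-preserving bijections from `S` to `Fin S.card`. -/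
theorem ncard_strictMono_equiv (S : Finset α) :
    {f : {x // x ∈ S} ≃ Fin S.card | StrictMono f}.ncard = (rankFunctions S).ncard := by
  refine Set.ncard_congr
    (fun f _ a => if h : a ∈ S then (f ⟨a, h⟩ : ℕ) else 0) ?_ ?_ ?_
  · intro f hf
    refine ⟨fun a ha => ?_, fun a ha b hb hab => ?_, fun a ha => ?_, fun a ha b hb hab => ?_⟩
    · simp [ha]
    · rw [Finset.mem_coe] at ha hb
      simp only [ha, hb, dite_true] at hab
      simpa using f.injective (Fin.ext hab)
    · simp [ha]
    · rw [Finset.mem_coe] at ha hb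
      simp only [ha, hb, dite_true]
      exact hf (a := ⟨a, ha⟩) (b := ⟨b, hb⟩) hab
  · intro f g _ _ hfg
    ext ⟨a, ha⟩
    simpa [ha] using congrFun hfg a
  · rintro f ⟨hlt, hinj, hzero, hmono⟩
    let g : {x // x ∈ S} → Fin S.card := fun a => ⟨f a, hlt a a.2⟩
    have hg : Function.Bijective g := by
      rw [Fintype.bijective_iff_injective_and_card]
      exact ⟨fun a b hab => Subtype.ext (hinj a.2 b.2 (Fin.mk.inj_iff.1 hab)), by simp⟩
    refine ⟨Equiv.ofBijective g hg, fun a b hab => hmono a.2 b.2 hab, ?_⟩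
    ext a
    by_cases h : a ∈ S
    · simp [h, g]
    · simp [h, hzero a h]

end ForestOrder

namespace RTree

variable {α : Type*} (T : RTree α)

theorem ancestor_trans {u v w : α} (huv : T.ancestor u v) (hvw : T.ancestor v w) :
    T.ancestor u w := by
  obtain ⟨k, rfl⟩ := huv
  obtain ⟨j, rfl⟩ := hvw
  exact ⟨k + j, Function.iterate_add_apply _ _ _ _⟩

theorem ancestor_antisymm {u v : α} (huv : T.ancestor u v) (hvu : T.ancestor v u) : u = v := by
  obtain ⟨k, hk⟩ := huv
  obtain ⟨j, hj⟩ := hvu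
  rcases Nat.eq_zero_or_pos k with rfl | hpos
  · exact hk.symm
  have hroot : ∀ n, T.parent^[n] T.root = T.root := Function.iterate_fixed T.parent_root
  have hper : T.parent^[j + k] v = v := by rw [Function.iterate_add_apply, hk, hj]
  obtain ⟨m, hm⟩ := T.reaches_root v
  have hv : v = T.root := by
    have hle : m ≤ (j + k) * m := Nat.le_mul_of_pos_left m (by omega)
    calc v = T.parent^[(j + k) * m] v := by
          rw [Function.iterate_mul, Function.iterate_fixed hper]
      _ = T.parent^[(j + k) * m - m] (T.parent^[m] v) := by
          rw [← Function.iterate_add_apply, Nat.sub_add_cancel hle]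
      _ = T.root := by rw [hm, hroot]
  rw [← hk, hv, hroot]

theorem ancestor_total {u v w : α} (hu : T.ancestor u w) (hv : T.ancestor v w) :
    T.ancestor v u ∨ T.ancestor u v := by
  obtain ⟨k, rfl⟩ := hu
  obtain ⟨j, rfl⟩ := hv
  rcases le_total k j with h | h
  · exact .inl ⟨j - k, by rw [← Function.iterate_add_apply, Nat.sub_add_cancel h]⟩
  · exact .inr ⟨k - j, by rw [← Function.iterate_add_apply, Nat.sub_add_cancel h]⟩

/-- The tree order, in which the ancestors of a node lie above it. -/
abbrev treeOrder : PartialOrder α where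
  le v u := T.ancestor u v
  le_refl v := ⟨0, rfl⟩
  le_trans _ _ _ huv hvw := T.ancestor_trans hvw huv
  le_antisymm _ _ huv hvu := T.ancestor_antisymm hvu huv

end RTree

/-- The hook-length formula for partial tree orders:
`|LE_S(T)| · ∏_{u ∈ S} |V(T_u) ∩ S| = |S|!`. -/
theorem hook_length_subset {α : Type*} [Fintype α] (T : RTree α) (S : Finset α) :
    (linExtsOn T S).ncard * ∏ u ∈ S, (T.subtree u ∩ ↑S).ncard = Nat.factorial S.card := by
  classical
  let _ := T.treeOrder
  have hlin : linExtsOn T S = {f : {x // x ∈ S} ≃ Fin S.card | StrictMono f} := by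
    ext f
    refine ⟨fun hf v u huv => hf u v ⟨huv.le, fun h => huv.ne (Subtype.ext h).symm⟩,
      fun hf u v huv => hf (lt_of_le_of_ne (α := {x // x ∈ S}) huv.1 fun h => huv.2 ?_)⟩
    rw [h]
  have hsub : ∀ u, (T.subtree u ∩ ↑S).ncard = (S.filter (· ≤ u)).card := by
    intro u
    rw [← Set.ncard_coe_finset]
    congr 1
    ext a
    rw [Finset.mem_coe, Finset.mem_filter, and_comm]
    rfl
  simp only [hsub]
  rw [hlin, ncard_strictMono_equiv]
  convert ncard_rankFunctions_mul_prod (fun _ _ _ => T.ancestor_total) S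
end

section
/- Let G be a tree, let T be an arbitrary rooting of G, and let p be a T-monotone priority function for G. Then the Cartesian tree Ind(G,p) is degenerate (it has exactly one leaf, i.e., every non-leaf node has exactly one child), and reading the nodes of Ind(G,p) from root to leaf lists V(G) in ascending order of priority p. -/
/-- `T` is an elimination tree on the (connected) graph `G`: every subtree of `T` induces a
connected subgraph of `G`, and every edge of `G` joins an ancestor-descendant pair of `T`.
(For connected `G` this is equivalent to the recursive definition: some vertex `r` is the
root, and the child subtrees of `r` are elimination trees on the components of `G − r`.) -/
def IsElimTree {α : Type*} (G : SimpleGraph α) (T : RTree α) : Prop :=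
  (∀ v : α, (G.induce (T.subtree v)).Connected) ∧
  (∀ u v : α, G.Adj u v → T.ancestor u v ∨ T.ancestor v u)

/-- `T` is the Cartesian tree `Ind(G,p)`: the (unique) elimination tree on `G` in which
`p(u) < p(v)` whenever `u` is a proper ancestor of `v`. -/
def IsCartesianTree {α : Type*} (G : SimpleGraph α) (p : α → ℝ) (T : RTree α) : Prop :=
  IsElimTree G T ∧ ∀ u v : α, T.properAncestor u v → p u < p v

/-- `T` is a rooting of the tree `G`: the parent-child pairs of `T` are exactly the edges
of `G`. -/
def IsRooting {α : Type*} (G : SimpleGraph α) (T : RTree α) : Prop :=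
  ∀ u v : α, G.Adj u v ↔ ((T.parent u = v ∧ u ≠ v) ∨ (T.parent v = u ∧ v ≠ u))

/-- `p` is a `T`-monotone priority function: `p` is injective and `p(v) < p(u)` whenever
`u` is a proper ancestor of `v` in `T`. -/
def IsMonotonePriority {α : Type*} (T : RTree α) (p : α → ℝ) : Prop :=
  Function.Injective p ∧ ∀ u v : α, T.properAncestor u v → p v < p u

namespace RTree

variable {α : Type*} {T : RTree α} {u v w : α}

theorem ancestor_refl (T : RTree α) (v : α) : T.ancestor v v := ⟨0, rfl⟩

theorem ancestor_parent (T : RTree α) (v : α) : T.ancestor (T.parent v) v := ⟨1, rfl⟩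

theorem ancestor.trans (huv : T.ancestor u v) (hvw : T.ancestor v w) : T.ancestor u w := by
  obtain ⟨k, rfl⟩ := huv
  obtain ⟨l, rfl⟩ := hvw
  exact ⟨k + l, Function.iterate_add_apply _ _ _ _⟩

/-- Two ancestors of the same node are comparable. -/
theorem ancestor.total (hu : T.ancestor u w) (hv : T.ancestor v w) :
    T.ancestor u v ∨ T.ancestor v u := by
  obtain ⟨k, rfl⟩ := hu
  obtain ⟨l, rfl⟩ := hv
  rcases le_total k l with h | h
  · exact Or.inr ⟨l - k, by rw [← Function.iterate_add_apply, Nat.sub_add_cancel h]⟩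
  · exact Or.inl ⟨k - l, by rw [← Function.iterate_add_apply, Nat.sub_add_cancel h]⟩

/-- A leaf is an ancestor of no node but itself. -/
theorem IsLeaf.eq_of_ancestor (hw : T.IsLeaf w) (h : T.ancestor w v) : v = w := by
  obtain ⟨k, hk⟩ := h
  induction k with
  | zero => exact hk
  | succ k ih =>
    rw [Function.iterate_succ_apply'] at hk
    exact ih (hw _ hk)

end RTree

/-- In a Cartesian tree, the descendants of `m` are closed under passing to neighbours of
priority at least `p m`. -/
theorem IsCartesianTree.ancestor_of_adj {α : Type*} {G : SimpleGraph α} {p : α → ℝ}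
    {S : RTree α} (hS : IsCartesianTree G p S) {m a b : α} (hma : S.ancestor m a)
    (hab : G.Adj a b) (hmb : p m ≤ p b) : S.ancestor m b := by
  rcases hS.1.2 a b hab with h | h
  · exact hma.trans h
  · rcases hma.total h with h' | h'
    · exact h'
    · by_cases hbm : b = m
      · exact hbm ▸ S.ancestor_refl b
      · exact absurd (hS.2 b m ⟨h', hbm⟩) hmb.not_gt

/-- If priorities increase towards the root of a rooting of `G`, then in a Cartesian tree on `G`
every node is an ancestor of all nodes of larger priority. -/
theorem IsCartesianTree.ancestor_of_le {α : Type*} {G : SimpleGraph α} {p : α → ℝ}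
    {T S : RTree α} (hS : IsCartesianTree G p S) (hT : IsRooting G T)
    (hp : IsMonotonePriority T p) {u v : α} (huv : p u ≤ p v) : S.ancestor u v := by
  have le_parent (x : α) : p x ≤ p (T.parent x) := by
    by_cases h : T.parent x = x
    · rw [h]
    · exact (hp.2 _ _ ⟨T.ancestor_parent x, h⟩).le
  have up (x : α) (hx : p u ≤ p x) (h : S.ancestor u x) : S.ancestor u (T.parent x) := by
    by_cases hne : T.parent x = x
    · rwa [hne]
    · exact hS.ancestor_of_adj h ((hT _ _).2 (Or.inl ⟨rfl, Ne.symm hne⟩))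
        (hx.trans (le_parent x))
  have down (x : α) (hx : p u ≤ p x) (h : S.ancestor u (T.parent x)) : S.ancestor u x := by
    by_cases hne : T.parent x = x
    · rwa [hne] at h
    · exact hS.ancestor_of_adj h ((hT _ _).2 (Or.inr ⟨rfl, Ne.symm hne⟩)) hx
  have root : S.ancestor u T.root := by
    obtain ⟨k, hk⟩ := T.reaches_root u
    have aux (k : ℕ) : p u ≤ p (T.parent^[k] u) ∧ S.ancestor u (T.parent^[k] u) := by
      induction k with
      | zero => exact ⟨le_rfl, S.ancestor_refl u⟩
      | succ k ih =>
        rw [Function.iterate_succ_apply']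
        exact ⟨ih.1.trans (le_parent _), up _ ih.1 ih.2⟩
    exact hk ▸ (aux k).2
  obtain ⟨k, hk⟩ := T.reaches_root v
  induction k generalizing v with
  | zero =>
    obtain rfl : v = T.root := hk
    exact root
  | succ k ih => exact down v huv (ih (huv.trans (le_parent v)) hk)

/-- If `G` is a tree, `T` a rooting of `G`, and `p` a `T`-monotone priority function, then
the Cartesian tree `Ind(G,p)` is degenerate (it has exactly one leaf), and reading its nodes
from root to leaf lists `V(G)` in ascending order of `p` (i.e. `p u < p v` iff `u` is a
proper ancestor of `v` in `Ind(G,p)`, for distinct `u, v`). -/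
theorem cartesianTree_of_monotone_degenerate {α : Type*} [Fintype α]
    (G : SimpleGraph α) (hG : G.IsTree) (T : RTree α) (hT : IsRooting G T)
    (p : α → ℝ) (hp : IsMonotonePriority T p)
    (S : RTree α) (hS : IsCartesianTree G p S) :
    (∃! v : α, S.IsLeaf v) ∧ ∀ u v : α, u ≠ v → (p u < p v ↔ S.properAncestor u v) := by
  have key (u v : α) (huv : u ≠ v) : p u < p v ↔ S.properAncestor u v :=
    ⟨fun h => ⟨hS.ancestor_of_le hT hp h.le, huv⟩, hS.2 u v⟩
  refine ⟨?_, key⟩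
  have : Nonempty α := ⟨S.root⟩
  obtain ⟨v, hv⟩ := Finite.exists_max p
  refine ⟨v, fun u hu => ?_, fun w hw => ?_⟩
  · by_contra hne
    exact (hS.2 v u ⟨hu ▸ S.ancestor_parent u, Ne.symm hne⟩).not_ge (hv u)
  · exact (hw.eq_of_ancestor (hS.ancestor_of_le hT hp (hv w))).symm
end
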